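/- Let m ≥ 1 be an integer, p > 1, q = p/(p−1), and M > 0. Let f : ℝ^d → ℝ be m-times continuously differentiable and suppose that for all x, y ∈ ℝ^d and h > 0, the function R(t) = Σ_{|α|=m} (m!/α!) y^α ∂^α f(x + t h y) satisfies (∫₀¹ |R(t)|^p dt)^{1/p} ≤ M ‖y‖₁^m, where ‖y‖₁ = Σᵢ |yᵢ|. Let K : ℝ^d → ℝ be integrable with ∫_{ℝ^d} K(y) dy = 1, ∫_{ℝ^d} y^α K(y) dy = 0 for all multi-indices α with 1 ≤ |α| ≤ m−1, and ∫_{ℝ^d} |K(y)| ‖y‖₁^m dy < ∞. Define fₕ(x) = h^{−d} ∫_{ℝ^d} K((x−y)/h) f(y) dy for h > 0. Then for every x ∈ ℝ^d and h > 0, |fₕ(x) − f(x)| ≤ (h^m /((m−1)!)) · (∫_{ℝ^d} |K(y)| ‖y‖₁^m dy) · M/((m−1)q+1)^{1/q}. -/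

import Mathlib

open MeasureTheory Finset

/-- The partial derivative of `g : ℝ^d → ℝ` in the `i`-th coordinate direction. -/
noncomputable def coordDeriv {d : ℕ} (i : Fin d) (g : EuclideanSpace ℝ (Fin d) → ℝ) :
    EuclideanSpace ℝ (Fin d) → ℝ :=
  fun x => fderiv ℝ g x (EuclideanSpace.single i 1)

/-- The mixed partial derivative `∂^α f` associated to a multi-index `α : Fin d → ℕ`. -/
noncomputable def mixedPartial {d : ℕ} (α : Fin d → ℕ) (f : EuclideanSpace ℝ (Fin d) → ℝ) :
    EuclideanSpace ℝ (Fin d) → ℝ :=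
  (List.ofFn fun i : Fin d => (coordDeriv i)^[α i]).foldr (fun F g => F g) f

lemma coordDeriv_contDiff {d n : ℕ} (i : Fin d) {g : EuclideanSpace ℝ (Fin d) → ℝ}
    (hg : ContDiff ℝ (n + 1 : ℕ) g) : ContDiff ℝ n (coordDeriv i g) := by
  unfold coordDeriv
  have : ContDiff ℝ n (fderiv ℝ g) := hg.fderiv_right (by norm_cast)
  exact this.clm_apply contDiff_const

lemma coordDeriv_comm {d : ℕ} (i j : Fin d) {g : EuclideanSpace ℝ (Fin d) → ℝ}
    (hg : ContDiff ℝ 2 g) : coordDeriv i (coordDeriv j g) = coordDeriv j (coordDeriv i g) := by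
  have h1 : Differentiable ℝ (fderiv ℝ g) := 
    (hg.fderiv_right (m := 1) (by norm_num)).differentiable (by norm_num)
  funext x
  have key : ∀ v w : EuclideanSpace ℝ (Fin d),
      fderiv ℝ (fun x => fderiv ℝ g x v) x w = fderiv ℝ (fderiv ℝ g) x w v := by
    intro v w
    rw [fderiv_clm_apply (h1 x) (differentiableAt_const _)]
    simp
  unfold coordDeriv
  rw [key, key]
  exact (hg.contDiffAt.isSymmSndFDerivAt (by simp)) _ _

lemma foldr_contDiff {d : ℕ} (L : List (Fin d)) : ∀ {n : ℕ} {g : EuclideanSpace ℝ (Fin d) → ℝ},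
    ContDiff ℝ (n + L.length : ℕ) g → ContDiff ℝ n (L.foldr coordDeriv g) := by
  induction L with
  | nil => intro n g hg; simpa using hg
  | cons a L ih =>
    intro n g hg
    apply coordDeriv_contDiff
    apply ih
    convert hg using 2
    simp; ring

lemma foldr_perm {d : ℕ} {L₁ L₂ : List (Fin d)} (h : L₁.Perm L₂)
    {g : EuclideanSpace ℝ (Fin d) → ℝ} (hg : ContDiff ℝ (L₁.length : ℕ) g) :
    L₁.foldr coordDeriv g = L₂.foldr coordDeriv g := by
  induction h with
  | nil => rfl
  | cons a h ih =>
    simp only [List.foldr_cons]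
    rw [ih (hg.of_le (by simp))]
  | swap a b l =>
    simp only [List.foldr_cons]
    apply coordDeriv_comm
    have := foldr_contDiff l (n := 2) (g := g) (by convert hg using 2; simp; ring)
    exact_mod_cast this
  | trans h1 h2 ih1 ih2 =>
    rw [ih1 hg, ih2 (by rw [← h1.length_eq]; exact hg)]

def idxList {d : ℕ} (α : Fin d → ℕ) : List (Fin d) :=
  (List.ofFn fun i : Fin d => List.replicate (α i) i).flatten

lemma mixedPartial_eq {d : ℕ} (α : Fin d → ℕ) (f : EuclideanSpace ℝ (Fin d) → ℝ) :
    mixedPartial α f = (idxList α).foldr coordDeriv f := by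
  unfold mixedPartial idxList
  rw [List.foldr_flatten, List.ofFn_eq_map, List.ofFn_eq_map, List.foldr_map, List.foldr_map]
  congr 1
  funext i g
  generalize α i = n
  induction n with
  | zero => rfl
  | succ n ih => rw [List.replicate_succ, List.foldr_cons, Function.iterate_succ_apply', ih]

lemma count_idxList {d : ℕ} (α : Fin d → ℕ) (i : Fin d) : (idxList α).count i = α i := by
  unfold idxList
  rw [List.count_flatten, List.ofFn_eq_map, List.map_map, ← List.ofFn_eq_map, List.sum_ofFn]
  simp [Function.comp, List.count_replicate]

lemma length_idxList {d : ℕ} (α : Fin d → ℕ) : (idxList α).length = ∑ i, α i := by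
  unfold idxList
  rw [List.length_flatten, List.ofFn_eq_map, List.map_map, ← List.ofFn_eq_map, List.sum_ofFn]
  simp [Function.comp]

lemma coordDeriv_mixedPartial {d m : ℕ} (α : Fin d → ℕ) (i : Fin d)
    {f : EuclideanSpace ℝ (Fin d) → ℝ} (hf : ContDiff ℝ m f) (h : ∑ i, α i + 1 ≤ m) :
    coordDeriv i (mixedPartial α f) = mixedPartial (α + Pi.single i 1) f := by
  rw [mixedPartial_eq, mixedPartial_eq]
  change (i :: idxList α).foldr coordDeriv f = _
  apply foldr_perm
  · rw [List.perm_iff_count]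
    intro j
    rw [List.count_cons, count_idxList, count_idxList]
    by_cases hij : i = j
    · subst hij; simp
    · simp [hij, Ne.symm hij]
  · apply hf.of_le
    simp only [List.length_cons, length_idxList]
    exact_mod_cast h

lemma mixedPartial_contDiff {d m n : ℕ} (α : Fin d → ℕ) 
    {f : EuclideanSpace ℝ (Fin d) → ℝ} (hf : ContDiff ℝ m f) (h : n + ∑ i, α i ≤ m) :
    ContDiff ℝ n (mixedPartial α f) := by
  rw [mixedPartial_eq]
  apply foldr_contDiff
  rw [length_idxList]
  exact hf.of_le (by exact_mod_cast h)

lemma fderiv_eq_sum_coordDeriv {d : ℕ} (g : EuclideanSpace ℝ (Fin d) → ℝ) 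
    (x y : EuclideanSpace ℝ (Fin d)) : fderiv ℝ g x y = ∑ i, y i * coordDeriv i g x := by
  unfold coordDeriv
  conv_lhs => rw [← (EuclideanSpace.basisFun (Fin d) ℝ).sum_repr y]
  simp

lemma comb_one {d k : ℕ} (i : Fin d) (G : (Fin d → ℕ) → ℝ) :
    ∑ α ∈ Finset.Nat.antidiagonalTuple d k, (1 / ∏ j, ((α j).factorial : ℝ)) * G (α + Pi.single i 1)
    = ∑ β ∈ Finset.Nat.antidiagonalTuple d (k+1), 
      ((β i : ℝ) / ∏ j, ((β j).factorial : ℝ)) * G β := by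
  have h0 : ∑ β ∈ Finset.Nat.antidiagonalTuple d (k+1), 
      ((β i : ℝ) / ∏ j, ((β j).factorial : ℝ)) * G β 
      = ∑ β ∈ (Finset.Nat.antidiagonalTuple d (k+1)).filter (fun β => β i ≠ 0), 
      ((β i : ℝ) / ∏ j, ((β j).factorial : ℝ)) * G β := by
    rw [Finset.sum_filter_of_ne]
    intro β _ hne h0
    apply hne; simp [h0]
  rw [h0]
  have hsub : ∀ β : Fin d → ℕ, β i ≠ 0 → β - Pi.single i 1 + Pi.single i 1 = β := by
    intro β hb
    funext j
    by_cases hj : j = i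
    · subst hj; simp; omega
    · simp [hj]
  refine Finset.sum_nbij' (fun α => α + Pi.single i 1) (fun β => β - Pi.single i 1) ?_ ?_ ?_ ?_ ?_
  · intro α ha
    rw [Finset.Nat.mem_antidiagonalTuple] at ha
    simp [Finset.Nat.mem_antidiagonalTuple, Finset.sum_add_distrib, ha]
  · intro β hb
    rw [Finset.mem_filter, Finset.Nat.mem_antidiagonalTuple] at hb
    rw [Finset.Nat.mem_antidiagonalTuple]
    have h1 := hb.1
    rw [← hsub β hb.2] at h1
    simp only [Pi.add_apply, Finset.sum_add_distrib] at h1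
    simp at h1
    simpa using h1
  · intro α _; simp
  · intro β hb
    exact hsub β (Finset.mem_filter.1 hb).2
  · intro α _
    congr 1
    have : ∏ j, (((α + Pi.single i 1 : Fin d → ℕ) j).factorial : ℝ) 
        = ((α i : ℝ) + 1) * ∏ j, ((α j).factorial : ℝ) := by
      rw [← Finset.mul_prod_erase _ _ (Finset.mem_univ i), 
        ← Finset.mul_prod_erase univ (fun j => ((α j).factorial : ℝ)) (Finset.mem_univ i), ← mul_assoc]
      congr 1
      · simp [Nat.factorial_succ]
      · apply Finset.prod_congr rfl
        intro j hj
        simp [Finset.ne_of_mem_erase hj]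
    rw [this]
    have h1 : (α i : ℝ) + 1 ≠ 0 := by positivity
    have h2 : ∏ j, ((α j).factorial : ℝ) ≠ 0 := by positivity
    simp
    field_simp

/-- k-th directional derivative. -/
noncomputable def dirD {d : ℕ} (f : EuclideanSpace ℝ (Fin d) → ℝ) (k : ℕ) 
    (y x : EuclideanSpace ℝ (Fin d)) : ℝ :=
  ∑ α ∈ Finset.Nat.antidiagonalTuple d k,
    ((k.factorial : ℝ) / ∏ i, ((α i).factorial : ℝ)) * (∏ i, (y i) ^ (α i)) * mixedPartial α f x

lemma dirD_succ {d m k : ℕ} {f : EuclideanSpace ℝ (Fin d) → ℝ} (hf : ContDiff ℝ m f) (hk : k + 1 ≤ m)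
    (y x : EuclideanSpace ℝ (Fin d)) : 
    ∑ α ∈ Finset.Nat.antidiagonalTuple d k,
    ((k.factorial : ℝ) / ∏ i, ((α i).factorial : ℝ)) * (∏ i, (y i) ^ (α i)) * 
      fderiv ℝ (mixedPartial α f) x y = dirD f (k+1) y x := by
  set G : (Fin d → ℕ) → ℝ := fun β => (∏ i, (y i) ^ (β i)) * mixedPartial β f x with hG
  have hprod : ∀ (α : Fin d → ℕ) (i : Fin d), 
      (∏ j, (y j) ^ ((α + Pi.single i 1 : Fin d → ℕ) j)) = y i * ∏ j, (y j) ^ (α j) := by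
    intro α i
    simp only [Pi.add_apply, pow_add, Finset.prod_mul_distrib]
    rw [mul_comm]
    congr 1
    rw [Finset.prod_eq_single i]
    · simp
    · intro b _ hb; simp [hb]
    · simp
  calc _ = ∑ α ∈ Finset.Nat.antidiagonalTuple d k, ∑ i, (k.factorial : ℝ) * 
        ((1 / ∏ j, ((α j).factorial : ℝ)) * G (α + Pi.single i 1)) := by
        apply Finset.sum_congr rfl
        intro α ha
        rw [Finset.Nat.mem_antidiagonalTuple] at ha
        rw [fderiv_eq_sum_coordDeriv, Finset.mul_sum]
        apply Finset.sum_congr rfl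
        intro i _
        rw [coordDeriv_mixedPartial α i hf (by omega), hG]
        simp only [hprod]
        ring
    _ = ∑ i, (k.factorial : ℝ) * ∑ β ∈ Finset.Nat.antidiagonalTuple d (k+1), 
      ((β i : ℝ) / ∏ j, ((β j).factorial : ℝ)) * G β := by
        rw [Finset.sum_comm]
        apply Finset.sum_congr rfl
        intro i _
        rw [← Finset.mul_sum, comb_one]
    _ = ∑ β ∈ Finset.Nat.antidiagonalTuple d (k+1), ∑ i, (k.factorial : ℝ) * 
      (((β i : ℝ) / ∏ j, ((β j).factorial : ℝ)) * G β) := by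
        simp only [Finset.mul_sum]
        rw [Finset.sum_comm]
    _ = _ := by
        unfold dirD
        apply Finset.sum_congr rfl
        intro β hb
        rw [Finset.Nat.mem_antidiagonalTuple] at hb
        rw [← Finset.mul_sum, ← Finset.sum_mul, ← Finset.sum_div, ← Nat.cast_sum, hb, 
          Nat.factorial_succ, hG]
        push_cast
        ring

lemma dirD_hasDerivAt {d m k : ℕ} {f : EuclideanSpace ℝ (Fin d) → ℝ} (hf : ContDiff ℝ m f) 
    (hk : k + 1 ≤ m) (y x : EuclideanSpace ℝ (Fin d)) (h t : ℝ) : 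
    HasDerivAt (fun t : ℝ => h ^ k * dirD f k y (x + (t * h) • y)) 
      (h ^ (k+1) * dirD f (k+1) y (x + (t * h) • y)) t := by
  have hline : HasDerivAt (fun t : ℝ => x + (t * h) • y) (h • y) t := by
    have := (((hasDerivAt_id t).mul_const h).smul_const y).const_add x
    simpa using this
  rw [← dirD_succ hf hk, pow_succ, mul_assoc, Finset.mul_sum]
  unfold dirD
  apply HasDerivAt.const_mul
  apply HasDerivAt.fun_sum
  intro α ha
  rw [Finset.Nat.mem_antidiagonalTuple] at ha
  have hd : Differentiable ℝ (mixedPartial α f) := 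
    (mixedPartial_contDiff (n := 1) α hf (by omega)).differentiable (by norm_num)
  have := (((hd (x + (t * h) • y)).hasFDerivAt).comp_hasDerivAt t hline).const_mul 
    (((k.factorial : ℝ) / ∏ i, ((α i).factorial : ℝ)) * (∏ i, (y i) ^ (α i)))
  refine this.congr_deriv ?_
  simp only [map_smul, smul_eq_mul]
  ring

lemma dirD_continuous {d m : ℕ} {f : EuclideanSpace ℝ (Fin d) → ℝ} (hf : ContDiff ℝ m f) 
    (y x : EuclideanSpace ℝ (Fin d)) (h : ℝ) : 
    Continuous (fun t : ℝ => dirD f m y (x + (t * h) • y)) := by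
  unfold dirD
  apply continuous_finsetSum
  intro α ha
  rw [Finset.Nat.mem_antidiagonalTuple] at ha
  have hd : Continuous (mixedPartial α f) := 
    (mixedPartial_contDiff (n := 0) α hf (by omega)).continuous
  fun_prop

lemma dirD_zero {d : ℕ} (f : EuclideanSpace ℝ (Fin d) → ℝ) (y x : EuclideanSpace ℝ (Fin d)) :
    dirD f 0 y x = f x := by
  unfold dirD
  rw [Finset.Nat.antidiagonalTuple_zero_right]
  simp [mixedPartial_eq]
  have : idxList (0 : Fin d → ℕ) = [] := by
    rw [← List.length_eq_zero_iff, length_idxList]; simp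
  rw [this]; rfl

/-- One-dimensional Taylor with integral remainder. -/
lemma taylor_one (g : ℕ → ℝ → ℝ) (n : ℕ)
    (hg : ∀ k, k ≤ n → ∀ t, HasDerivAt (g k) (g (k+1) t) t) (hc : Continuous (g (n+1))) :
    g 0 1 = ∑ k ∈ Finset.range (n+1), g k 0 / (k.factorial : ℝ) 
      + (∫ t in (0:ℝ)..1, (1 - t) ^ n * g (n+1) t) / (n.factorial : ℝ) := by
  have hder : ∀ j, j ≤ n → ∀ t, HasDerivAt 
      (fun t => ∑ k ∈ Finset.range (j+1), (1-t)^k * g k t / (k.factorial : ℝ)) 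
      ((1 - t) ^ j * g (j+1) t / (j.factorial : ℝ)) t := by
    intro j
    induction j with
    | zero => intro _ t; simpa using hg 0 (Nat.zero_le _) t
    | succ j ih =>
      intro hj t
      have h1 := ih (by omega) t
      have h2 : HasDerivAt (fun t : ℝ => (1 - t)) (-1) t := by
        simpa using (hasDerivAt_id t).const_sub 1
      have h3 := ((h2.fun_pow (j+1)).mul (hg (j+1) hj t)).div_const ((j+1).factorial : ℝ)
      simp only [Finset.sum_range_succ _ (j+1)]
      refine (h1.add h3).congr_deriv ?_
      have h5 : (j.factorial : ℝ) ≠ 0 := by positivity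
      have h6 : ((j : ℝ) + 1) ≠ 0 := by positivity
      rw [Nat.factorial_succ]
      push_cast
      field_simp
      ring
  have := intervalIntegral.integral_eq_sub_of_hasDerivAt (a := 0) (b := 1) 
    (fun t _ => hder n le_rfl t) (Continuous.intervalIntegrable (by fun_prop) _ _)
  rw [intervalIntegral.integral_div] at this
  rw [this]
  simp only [sub_self, sub_zero, one_pow, one_mul]
  rw [Finset.sum_range_succ' (fun k => (0:ℝ)^k * g k 1 / (k.factorial : ℝ))]
  simp

lemma holder_bound (n : ℕ) {p q : ℝ} (hpq : p.HolderConjugate q) (R : ℝ → ℝ) (hc : Continuous R) :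
    |∫ t in (0:ℝ)..1, (1 - t) ^ n * R t| ≤ 
      (1 / ((n : ℝ) * q + 1) ^ (1 / q)) * (∫ t in (0:ℝ)..1, |R t| ^ p) ^ (1 / p) := by
  have hq := hpq.symm.pos
  have hmem : ∀ (g : ℝ → ℝ) (r : ENNReal), Continuous g → 
      MemLp g r (volume.restrict (Set.Ioc (0:ℝ) 1)) := by
    intro g r hg
    obtain ⟨C, hC⟩ := (isCompact_Icc (a := (0:ℝ)) (b := 1)).exists_bound_of_continuousOn hg.continuousOn
    refine MemLp.of_bound hg.aestronglyMeasurable C ?_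
    refine (ae_restrict_iff' measurableSet_Ioc).2 (Filter.Eventually.of_forall ?_)
    intro t ht
    exact hC t (Set.Ioc_subset_Icc_self ht)
  have h1 : |∫ t in (0:ℝ)..1, (1 - t) ^ n * R t| ≤ ∫ t in (0:ℝ)..1, |1 - t| ^ n * |R t| := by
    refine (intervalIntegral.abs_integral_le_integral_abs zero_le_one).trans ?_
    simp [abs_mul]
  refine h1.trans ?_
  have h2 := integral_mul_le_Lp_mul_Lq_of_nonneg (μ := volume.restrict (Set.Ioc (0:ℝ) 1)) hpq.symm
    (f := fun t => |1 - t| ^ n) (g := fun t => |R t|) 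
    (Filter.Eventually.of_forall fun t => by positivity) 
    (Filter.Eventually.of_forall fun t => by positivity)
    (hmem _ _ (by fun_prop)) (hmem _ _ (by fun_prop))
  have h3 : ∫ t in (0:ℝ)..1, (|1 - t| ^ n) ^ q = 1 / ((n : ℝ) * q + 1) := by
    have : ∫ t in (0:ℝ)..1, (|1 - t| ^ n) ^ q = ∫ t in (0:ℝ)..1, (1 - t) ^ ((n : ℝ) * q) := by
      apply intervalIntegral.integral_congr
      intro t ht
      rw [Set.uIcc_of_le zero_le_one] at ht
      have : 0 ≤ 1 - t := by linarith [ht.2]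
      simp only [abs_of_nonneg this]
      rw [← Real.rpow_natCast, ← Real.rpow_mul this]
    rw [this, intervalIntegral.integral_comp_sub_left (fun t => t ^ ((n : ℝ) * q))]
    have hnq : 0 ≤ (n : ℝ) * q := by positivity
    rw [integral_rpow (Or.inl (by linarith))]
    simp [Real.zero_rpow (by positivity : (n : ℝ) * q + 1 ≠ 0)]
  rw [← intervalIntegral.integral_of_le zero_le_one, ← intervalIntegral.integral_of_le zero_le_one,
    ← intervalIntegral.integral_of_le zero_le_one, h3, 
    Real.div_rpow zero_le_one (by positivity), Real.one_rpow] at h2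
  exact h2

lemma mono_bound {d : ℕ} (α : Fin d → ℕ) (y : EuclideanSpace ℝ (Fin d)) :
    |∏ i, (y i) ^ (α i)| ≤ (∑ i, |y i|) ^ (∑ i, α i) := by
  rw [Finset.abs_prod, ← Finset.prod_pow_eq_pow_sum]
  apply Finset.prod_le_prod
  · intro i _; positivity
  · intro i _
    rw [abs_pow]
    gcongr
    exact Finset.single_le_sum (f := fun i => |y i|) (fun j _ => abs_nonneg _) (Finset.mem_univ i)

lemma mono_integrable {d m : ℕ} {K : EuclideanSpace ℝ (Fin d) → ℝ} (hKint : Integrable K)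
    (hKabs : Integrable (fun y : EuclideanSpace ℝ (Fin d) => |K y| * (∑ i, |y i|) ^ m))
    (α : Fin d → ℕ) (hα : ∑ i, α i ≤ m) :
    Integrable (fun y : EuclideanSpace ℝ (Fin d) => (∏ i, (y i) ^ (α i)) * K y) := by
  refine (hKint.abs.add hKabs).mono' ?_ (Filter.Eventually.of_forall ?_)
  · exact (Continuous.aestronglyMeasurable (by fun_prop)).mul hKint.aestronglyMeasurable
  · intro y
    have h1 := mono_bound α y
    have h0 : 0 ≤ ∑ i, |y i| := by positivity
    have h2 : (∑ i, |y i|) ^ (∑ i, α i) ≤ 1 + (∑ i, |y i|) ^ m := by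
      rcases le_total (∑ i, |y i|) 1 with h | h
      · have := pow_le_one₀ (n := ∑ i, α i) h0 h
        have : 0 ≤ (∑ i, |y i|) ^ m := by positivity
        linarith
      · have := pow_le_pow_right₀ h hα
        linarith
    rw [Real.norm_eq_abs, abs_mul]
    simp only [Pi.add_apply]
    nlinarith [abs_nonneg (K y)]

/-- Bias bound for kernel smoothing: if `f` is `C^m` with an `L^p`-control of size `M ‖y‖₁^m`
on the `m`-th order Taylor remainder integrand, and `K` is an order-`m` kernel
(`∫ K = 1`, vanishing moments up to order `m−1`, finite `m`-th absolute moment), then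
`|fₕ(x) − f(x)| ≤ (h^m/(m−1)!) (∫ |K(y)| ‖y‖₁^m dy) M / ((m−1)q+1)^{1/q}`
where `fₕ(x) = h^{−d} ∫ K((x−y)/h) f(y) dy`. -/
theorem kernel_smoothing_bias_bound {d m : ℕ} (hm : 1 ≤ m) {p q : ℝ} (hp : 1 < p)
    (hq : q = p / (p - 1)) {M : ℝ} (hM : 0 < M)
    (f : EuclideanSpace ℝ (Fin d) → ℝ) (hf : ContDiff ℝ m f)
    (hR : ∀ (x y : EuclideanSpace ℝ (Fin d)) (h : ℝ), 0 < h →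
      (∫ t in (0:ℝ)..1,
          |∑ α ∈ Finset.Nat.antidiagonalTuple d m,
              ((m.factorial : ℝ) / ∏ i, ((α i).factorial : ℝ)) * (∏ i, (y i) ^ (α i)) *
                mixedPartial α f (x + (t * h) • y)| ^ p) ^ (1 / p)
        ≤ M * (∑ i, |y i|) ^ m)
    (K : EuclideanSpace ℝ (Fin d) → ℝ) (hKint : Integrable K)
    (hKone : ∫ y, K y = 1)
    (hKmom : ∀ α : Fin d → ℕ, 1 ≤ ∑ i, α i → ∑ i, α i ≤ m - 1 →
      ∫ y : EuclideanSpace ℝ (Fin d), (∏ i, (y i) ^ (α i)) * K y = 0)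
    (hKabs : Integrable (fun y : EuclideanSpace ℝ (Fin d) => |K y| * (∑ i, |y i|) ^ m)) :
    ∀ (x : EuclideanSpace ℝ (Fin d)) (h : ℝ), 0 < h →
      |(h ^ d)⁻¹ * (∫ y : EuclideanSpace ℝ (Fin d), K (h⁻¹ • (x - y)) * f y) - f x|
        ≤ (h ^ m / ((m - 1).factorial : ℝ)) *
            (∫ y : EuclideanSpace ℝ (Fin d), |K y| * (∑ i, |y i|) ^ m) *
            M / (((m:ℝ) - 1) * q + 1) ^ (1 / q) := by
  intro x h hh
  obtain ⟨n, rfl⟩ : ∃ n, m = n + 1 := ⟨m - 1, by omega⟩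
  have hpq : p.HolderConjugate q := (Real.holderConjugate_iff_eq_conjExponent hp).2 hq
  have hqpos := hpq.symm.pos
  -- change of variables
  have hcv : (h ^ d)⁻¹ * (∫ y : EuclideanSpace ℝ (Fin d), K (h⁻¹ • (x - y)) * f y)
      = ∫ z : EuclideanSpace ℝ (Fin d), K z * f (x - h • z) := by
    have h1 := integral_sub_left_eq_self
      (fun u : EuclideanSpace ℝ (Fin d) => K (h⁻¹ • u) * f (x - u)) volume x
    simp only [sub_sub_cancel] at h1
    have h2 := Measure.integral_comp_inv_smul_of_nonneg volume
      (fun z : EuclideanSpace ℝ (Fin d) => K z * f (x - h • z)) hh.le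
    simp only [smul_inv_smul₀ hh.ne', finrank_euclideanSpace_fin, smul_eq_mul] at h2
    rw [h1, h2, inv_mul_cancel_left₀ (by positivity)]
  rw [hcv]
  set P : EuclideanSpace ℝ (Fin d) → ℝ := fun z =>
    ∑ k ∈ Finset.range (n+1), h ^ k * dirD f k (-z) x / (k.factorial : ℝ) with hP
  set C : ℝ := h ^ (n+1) / (n.factorial : ℝ) * M / ((n : ℝ) * q + 1) ^ (1 / q) with hC
  have hrem : ∀ z, |f (x - h • z) - P z| ≤ C * (∑ i, |z i|) ^ (n+1) := by
    intro z
    have ht := taylor_one (fun k t => h ^ k * dirD f k (-z) (x + (t * h) • (-z))) n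
      (fun k hk t => dirD_hasDerivAt hf (by omega) (-z) x h t)
      (continuous_const.mul (dirD_continuous hf (-z) x h))
    simp only [dirD_zero, pow_zero, one_mul, zero_mul, zero_smul, smul_neg,
      ← sub_eq_add_neg, sub_zero] at ht
    rw [ht, hP]
    simp only [add_sub_cancel_left]
    have e : ∀ t : ℝ, (1 - t) ^ n * (h ^ (n+1) * dirD f (n+1) (-z) (x - (t * h) • z))
        = h ^ (n+1) * ((1 - t) ^ n * dirD f (n+1) (-z) (x + (t * h) • (-z))) := by
      intro t; rw [smul_neg, ← sub_eq_add_neg]; ring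
    simp only [e]
    rw [intervalIntegral.integral_const_mul, abs_div, abs_mul, abs_of_pos (pow_pos hh _),
      abs_of_pos (by positivity : (0:ℝ) < (n.factorial : ℝ))]
    have hb := holder_bound n hpq _ (dirD_continuous hf (-z) x h)
    have hr := hR x (-z) h hh
    change (∫ t in (0:ℝ)..1, |dirD f (n+1) (-z) (x + (t * h) • (-z))| ^ p) ^ (1 / p) ≤ _ at hr
    simp only [PiLp.neg_apply, abs_neg] at hr
    have hb2 := hb.trans (mul_le_mul_of_nonneg_left hr (by positivity))
    calc _ ≤ h ^ (n+1) * (1 / ((n : ℝ) * q + 1) ^ (1 / q) * (M * (∑ i, |z i|) ^ (n+1)))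
          / (n.factorial : ℝ) := by gcongr
      _ = _ := by rw [hC]; ring
  -- polynomial part
  have hmonoint : ∀ α : Fin d → ℕ, ∑ i, α i ≤ n + 1 → Integrable
      (fun z : EuclideanSpace ℝ (Fin d) => (∏ i, ((-z) i) ^ (α i)) * K z) := by
    intro α hα
    have := (mono_integrable hKint hKabs α hα).const_mul (∏ i, (-1 : ℝ) ^ (α i))
    refine this.congr (Filter.Eventually.of_forall fun z => ?_)
    simp only [PiLp.neg_apply]
    rw [← mul_assoc, ← Finset.prod_mul_distrib]
    congr 1
    exact Finset.prod_congr rfl fun i _ => (neg_pow (z i) (α i)).symm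
  have hmonozero : ∀ α : Fin d → ℕ, 1 ≤ ∑ i, α i → ∑ i, α i ≤ n →
      ∫ z : EuclideanSpace ℝ (Fin d), (∏ i, ((-z) i) ^ (α i)) * K z = 0 := by
    intro α h1 h2
    have := hKmom α h1 (by simpa using h2)
    calc _ = ∫ z : EuclideanSpace ℝ (Fin d), (∏ i, (-1 : ℝ) ^ (α i)) *
            ((∏ i, (z i) ^ (α i)) * K z) := by
          congr 1; funext z
          simp only [PiLp.neg_apply]
          rw [← mul_assoc, ← Finset.prod_mul_distrib]
          congr 1
          exact Finset.prod_congr rfl fun i _ => (neg_pow (z i) (α i))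
      _ = 0 := by rw [integral_const_mul, this, mul_zero]
  have hexp : ∀ k (z : EuclideanSpace ℝ (Fin d)),
      K z * (h ^ k * dirD f k (-z) x / (k.factorial : ℝ)) =
      ∑ α ∈ Finset.Nat.antidiagonalTuple d k, (h ^ k / (k.factorial : ℝ) *
        ((k.factorial : ℝ) / ∏ i, ((α i).factorial : ℝ)) * mixedPartial α f x) *
        ((∏ i, ((-z) i) ^ (α i)) * K z) := by
    intro k z
    unfold dirD
    rw [Finset.mul_sum, Finset.sum_div, Finset.mul_sum]
    exact Finset.sum_congr rfl fun α _ => by ring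
  have hkint : ∀ k, k ≤ n → Integrable (fun z : EuclideanSpace ℝ (Fin d) =>
      K z * (h ^ k * dirD f k (-z) x / (k.factorial : ℝ))) := by
    intro k hk
    simp only [hexp]
    refine integrable_finsetSum _ fun α ha => ?_
    rw [Finset.Nat.mem_antidiagonalTuple] at ha
    exact (hmonoint α (by omega)).const_mul _
  have hkzero : ∀ k, 1 ≤ k → k ≤ n → ∫ z : EuclideanSpace ℝ (Fin d),
      K z * (h ^ k * dirD f k (-z) x / (k.factorial : ℝ)) = 0 := by
    intro k hk1 hk
    simp only [hexp]
    rw [integral_finsetSum]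
    · refine Finset.sum_eq_zero fun α ha => ?_
      rw [Finset.Nat.mem_antidiagonalTuple] at ha
      rw [integral_const_mul, hmonozero α (by omega) (by omega), mul_zero]
    · intro α ha
      rw [Finset.Nat.mem_antidiagonalTuple] at ha
      exact (hmonoint α (by omega)).const_mul _
  have hPint : Integrable (fun z => K z * P z) := by
    simp only [hP, Finset.mul_sum]
    refine integrable_finsetSum _ fun k hk => hkint k ?_
    have := Finset.mem_range.1 hk
    omega
  have hPval : ∫ z, K z * P z = f x := by
    simp only [hP, Finset.mul_sum]
    rw [integral_finsetSum _ (fun k hk => hkint k (by have := Finset.mem_range.1 hk; omega)),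
      Finset.sum_range_succ', Finset.sum_eq_zero]
    · simp only [dirD_zero, pow_zero, one_mul, Nat.factorial_zero, Nat.cast_one, div_one, zero_add]
      rw [integral_mul_const, hKone, one_mul]
    · intro k hk
      have := Finset.mem_range.1 hk
      exact hkzero (k+1) (by omega) (by omega)
  have hbd : ∀ z, |K z * (f (x - h • z) - P z)| ≤ C * (|K z| * (∑ i, |z i|) ^ (n+1)) := by
    intro z
    rw [abs_mul]
    calc _ ≤ |K z| * (C * (∑ i, |z i|) ^ (n+1)) := by gcongr; exact hrem z
      _ = _ := by ring
  have hmeas : AEStronglyMeasurable (fun z => K z * (f (x - h • z) - P z)) volume := by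
    have h1 : AEStronglyMeasurable (fun z => K z * f (x - h • z)) volume := by
      refine hKint.aestronglyMeasurable.mul (Continuous.aestronglyMeasurable ?_)
      have := hf.continuous
      fun_prop
    refine (h1.sub hPint.aestronglyMeasurable).congr (Filter.Eventually.of_forall fun z => ?_)
    simp only [Pi.sub_apply]
    ring
  have hremint : Integrable (fun z => K z * (f (x - h • z) - P z)) :=
    (hKabs.const_mul C).mono' hmeas (Filter.Eventually.of_forall hbd)
  have hsplit : (∫ z : EuclideanSpace ℝ (Fin d), K z * f (x - h • z)) - f x
      = ∫ z, K z * (f (x - h • z) - P z) := by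
    have := integral_add hPint hremint
    rw [hPval] at this
    rw [sub_eq_iff_eq_add', ← this]
    congr 1; funext z; ring
  rw [hsplit]
  calc _ ≤ ∫ z, |K z * (f (x - h • z) - P z)| := abs_integral_le_integral_abs
    _ ≤ ∫ z, C * (|K z| * (∑ i, |z i|) ^ (n+1)) :=
        integral_mono hremint.abs (hKabs.const_mul C) hbd
    _ = _ := by
        rw [integral_const_mul, hC]
        push_cast
        rw [add_sub_cancel_right]
        ring
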